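/- arXiv:2406.04115 — 5 statements merged into one kernel-verified Lean document; each statement's English description precedes it below -/
import Mathlib

section
/- Let V be a finite set, let w : V → V → ℝ be a symmetric weight function with w i j ≥ 0 for all i, j, and let B ⊆ V be a nonempty set of boundary vertices. For f : V → ℝ² define the discrete Dirichlet energy E(f) = (1/2) · Σ_{i ∈ V} Σ_{j ∈ V} w i j · ‖f i − f j‖². Assume that every vertex of V can be joined to some vertex of B by a path along edges of strictly positive weight. Then for every boundary assignment b : V → ℝ² there exists a unique f : V → ℝ² with f i = b i for all i ∈ B that minimizes E among all functions agreeing with b on B. -/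
open Finset

/-- The discrete Dirichlet energy of a map `f : V → ℝ²` with respect to edge weights `w`. -/
noncomputable def discreteEnergy {V : Type*} [Fintype V] (w : V → V → ℝ)
    (f : V → EuclideanSpace ℝ (Fin 2)) : ℝ :=
  (1 / 2) * ∑ i : V, ∑ j : V, w i j * ‖f i - f j‖ ^ 2

theorem dE_term {V : Type*} [Fintype V] (w : V → V → ℝ) (hnonneg : ∀ i j, 0 ≤ w i j)
    (f : V → EuclideanSpace ℝ (Fin 2)) (i j : V) :
    w i j * ‖f i - f j‖ ^ 2 ≤ 2 * discreteEnergy w f := by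
  have hn : ∀ i j, 0 ≤ w i j * ‖f i - f j‖ ^ 2 :=
    fun i j => mul_nonneg (hnonneg i j) (sq_nonneg _)
  have h1 : w i j * ‖f i - f j‖ ^ 2 ≤ ∑ j : V, w i j * ‖f i - f j‖ ^ 2 :=
    Finset.single_le_sum (f := fun j => w i j * ‖f i - f j‖ ^ 2)
      (fun j _ => hn i j) (Finset.mem_univ j)
  have h2 : ∑ j : V, w i j * ‖f i - f j‖ ^ 2 ≤ ∑ i : V, ∑ j : V, w i j * ‖f i - f j‖ ^ 2 :=
    Finset.single_le_sum (f := fun i => ∑ j : V, w i j * ‖f i - f j‖ ^ 2)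
      (fun i _ => Finset.sum_nonneg fun j _ => hn i j) (Finset.mem_univ i)
  unfold discreteEnergy
  linarith

theorem dE_mid {V : Type*} [Fintype V] (w : V → V → ℝ)
    (f g : V → EuclideanSpace ℝ (Fin 2)) :
    discreteEnergy w (fun i => (1 / 2 : ℝ) • (f i + g i)) =
      (1 / 2) * discreteEnergy w f + (1 / 2) * discreteEnergy w g
        - (1 / 4) * discreteEnergy w (fun i => f i - g i) := by
  unfold discreteEnergy
  simp only [Finset.mul_sum, ← Finset.sum_add_distrib, ← Finset.sum_sub_distrib]
  refine Finset.sum_congr rfl fun i _ => Finset.sum_congr rfl fun j _ => ?_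
  have e1 : (1 / 2 : ℝ) • (f i + g i) - (1 / 2 : ℝ) • (f j + g j)
      = (1 / 2 : ℝ) • ((f i - f j) + (g i - g j)) := by module
  have e2 : f i - g i - (f j - g j) = (f i - f j) - (g i - g j) := by module
  have hp := parallelogram_law_with_norm ℝ (f i - f j) (g i - g j)
  rw [e1, e2, norm_smul, Real.norm_eq_abs, abs_of_pos (by norm_num : (0 : ℝ) < 1 / 2)]
  linear_combination (w i j / 8) * hp

theorem dE_bound {V : Type*} [Fintype V] (w : V → V → ℝ) (hnonneg : ∀ i j, 0 ≤ w i j)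
    (B : Finset V) (b : V → EuclideanSpace ℝ (Fin 2)) (M : ℝ) (i k : V) (hk : k ∈ B)
    (h : Relation.ReflTransGen (fun a b => 0 < w a b) i k) :
    ∃ C : ℝ, ∀ f : V → EuclideanSpace ℝ (Fin 2), (∀ i ∈ B, f i = b i) →
      discreteEnergy w f ≤ M → ‖f i‖ ≤ C := by
  induction h using Relation.ReflTransGen.head_induction_on with
  | refl => exact ⟨‖b k‖, fun f hf _ => by rw [hf k hk]⟩
  | @head a c hac _ ih =>
    obtain ⟨C, hC⟩ := ih
    refine ⟨Real.sqrt (2 * M / w a c) + C, fun f hf hM => ?_⟩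
    have h1 := hC f hf hM
    have h2 := dE_term w hnonneg f a c
    have h3 : ‖f a - f c‖ ≤ Real.sqrt (2 * M / w a c) := by
      apply Real.le_sqrt_of_sq_le
      rw [le_div_iff₀ hac]
      linarith
    have h4 : ‖f a‖ ≤ ‖f a - f c‖ + ‖f c‖ := by
      simpa using norm_add_le (f a - f c) (f c)
    linarith

theorem dE_zero {V : Type*} [Fintype V] (w : V → V → ℝ) (hnonneg : ∀ i j, 0 ≤ w i j)
    (d : V → EuclideanSpace ℝ (Fin 2)) (hd : discreteEnergy w d ≤ 0) (i k : V)
    (hk : d k = 0) (h : Relation.ReflTransGen (fun a b => 0 < w a b) i k) : d i = 0 := by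
  induction h using Relation.ReflTransGen.head_induction_on with
  | refl => exact hk
  | @head a c hac _ ih =>
    have h2 := dE_term w hnonneg d a c
    rw [ih, sub_zero] at h2
    have h3 : ‖d a‖ ^ 2 ≤ 0 := by
      by_contra hh
      have := mul_pos hac (not_le.mp hh)
      linarith
    have h4 : ‖d a‖ = 0 := pow_eq_zero_iff (two_ne_zero) |>.mp (le_antisymm h3 (sq_nonneg _))
    exact norm_eq_zero.mp h4

/-- Existence and uniqueness of the minimizer of the discrete Dirichlet energy with
prescribed boundary values, assuming nonnegative symmetric weights and that every vertex
is connected to the boundary through edges of strictly positive weight. -/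
theorem exists_unique_discrete_harmonic_minimizer
    {V : Type*} [Fintype V] (w : V → V → ℝ)
    (hsymm : ∀ i j, w i j = w j i) (hnonneg : ∀ i j, 0 ≤ w i j)
    (B : Finset V) (hB : B.Nonempty)
    (hconn : ∀ i : V, ∃ k ∈ B, Relation.ReflTransGen (fun a b => 0 < w a b) i k)
    (b : V → EuclideanSpace ℝ (Fin 2)) :
    ∃! f : V → EuclideanSpace ℝ (Fin 2),
      (∀ i ∈ B, f i = b i) ∧
      ∀ g : V → EuclideanSpace ℝ (Fin 2), (∀ i ∈ B, g i = b i) →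
        discreteEnergy w f ≤ discreteEnergy w g := by
  have hcont : Continuous (discreteEnergy w) := by
    unfold discreteEnergy
    fun_prop
  have hbd : ∀ i : V, ∃ C : ℝ, ∀ f : V → EuclideanSpace ℝ (Fin 2), (∀ i ∈ B, f i = b i) →
      discreteEnergy w f ≤ discreteEnergy w b → ‖f i‖ ≤ C := by
    intro i
    obtain ⟨k, hk, h⟩ := hconn i
    exact dE_bound w hnonneg B b _ i k hk h
  choose C hC using hbd
  let K : Set (V → EuclideanSpace ℝ (Fin 2)) :=
    {f | (∀ i ∈ B, f i = b i) ∧ discreteEnergy w f ≤ discreteEnergy w b}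
  have hKc : IsClosed K := by
    refine IsClosed.inter ?_ (isClosed_le hcont continuous_const)
    have : {f : V → EuclideanSpace ℝ (Fin 2) | ∀ i ∈ B, f i = b i}
        = ⋂ i ∈ B, {f | f i = b i} := by
      ext f; simp
    change IsClosed {f : V → EuclideanSpace ℝ (Fin 2) | ∀ i ∈ B, f i = b i}
    rw [this]
    exact isClosed_biInter fun i _ => isClosed_eq (continuous_apply i) continuous_const
  have hK : IsCompact K := by
    refine IsCompact.of_isClosed_subset
      (isCompact_univ_pi fun i => isCompact_closedBall (0 : EuclideanSpace ℝ (Fin 2)) (C i))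
      hKc ?_
    intro f hf i _
    rw [mem_closedBall_zero_iff]
    exact hC i f hf.1 hf.2
  obtain ⟨f, hf, hmin⟩ := hK.exists_isMinOn ⟨b, fun _ _ => rfl, le_rfl⟩ hcont.continuousOn
  have hfmin : ∀ g : V → EuclideanSpace ℝ (Fin 2), (∀ i ∈ B, g i = b i) →
      discreteEnergy w f ≤ discreteEnergy w g := by
    intro g hg
    by_cases h : discreteEnergy w g ≤ discreteEnergy w b
    · exact hmin (show g ∈ K from ⟨hg, h⟩)
    · exact hf.2.trans (not_le.mp h).le
  refine ⟨f, ⟨hf.1, hfmin⟩, ?_⟩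
  rintro g ⟨hgB, hgmin⟩
  have hm := hfmin (fun i => (1 / 2 : ℝ) • (g i + f i)) (fun i hi => by
    simp only [hgB i hi, hf.1 i hi]
    module)
  have hgf := hgmin f hf.1
  rw [dE_mid] at hm
  funext i
  obtain ⟨k, hk, h⟩ := hconn i
  exact sub_eq_zero.mp (dE_zero w hnonneg (fun i => g i - f i) (by linarith) i k
    (by simp [hgB k hk, hf.1 k hk]) h)
end

section
/- Let V be a finite set, let w : V → V → ℝ be a symmetric weight function with w i j ≥ 0 for all i, j, and let B ⊆ V be a nonempty set of boundary vertices such that every vertex of V can be joined to some vertex of B by a path along edges of strictly positive weight. If f : V → ℝ satisfies the discrete Laplace equation Σ_{j ∈ V} w i j · (f i − f j) = 0 at every vertex i ∉ B, then for every i ∈ V, min_{k ∈ B} f k ≤ f i ≤ max_{k ∈ B} f k. -/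
open Finset

/-- The global maximum of a discrete harmonic function is attained on the boundary. -/
theorem exists_boundary_max
    {V : Type*} [Fintype V] (w : V → V → ℝ) (hnonneg : ∀ i j, 0 ≤ w i j)
    (B : Finset V) (hB : B.Nonempty)
    (hconn : ∀ i : V, ∃ k ∈ B, Relation.ReflTransGen (fun a b => 0 < w a b) i k)
    (f : V → ℝ)
    (hharm : ∀ i : V, i ∉ B → ∑ j : V, w i j * (f i - f j) = 0) :
    ∃ k ∈ B, ∀ i, f i ≤ f k := by
  obtain ⟨b, _⟩ := hB
  obtain ⟨m, -, hm⟩ := Finset.exists_max_image univ f ⟨b, mem_univ b⟩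
  obtain ⟨k, hk, hpath⟩ := hconn m
  have key : (∀ i, f i ≤ f m) → ∃ k ∈ B, ∀ i, f i ≤ f k := by
    induction hpath using Relation.ReflTransGen.head_induction_on with
    | refl => exact fun h => ⟨k, hk, h⟩
    | @head a c hac _ ih =>
      intro h
      by_cases ha : a ∈ B
      · exact ⟨a, ha, h⟩
      · have h0 := (Finset.sum_eq_zero_iff_of_nonneg (fun j _ =>
          mul_nonneg (hnonneg a j) (sub_nonneg.2 (h j)))).1 (hharm a ha) c (mem_univ c)
        have hfc : f a - f c = 0 := (mul_eq_zero.1 h0).resolve_left hac.ne'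
        have hfe : f a = f c := sub_eq_zero.1 hfc
        have h' : ∀ i, f i ≤ f c := fun i => hfe ▸ h i
        exact ih (fun i _ => h' i) h'
  exact key fun i => hm i (mem_univ i)

/-- Discrete maximum principle: a real-valued function that is discrete harmonic at all
interior vertices attains its values between the minimum and maximum of its boundary
values, provided every vertex connects to the boundary through positive-weight edges. -/
theorem discrete_maximum_principle
    {V : Type*} [Fintype V] (w : V → V → ℝ)
    (hsymm : ∀ i j, w i j = w j i) (hnonneg : ∀ i j, 0 ≤ w i j)
    (B : Finset V) (hB : B.Nonempty)
    (hconn : ∀ i : V, ∃ k ∈ B, Relation.ReflTransGen (fun a b => 0 < w a b) i k)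
    (f : V → ℝ)
    (hharm : ∀ i : V, i ∉ B → ∑ j : V, w i j * (f i - f j) = 0) :
    ∀ i : V, B.inf' hB f ≤ f i ∧ f i ≤ B.sup' hB f := by
  intro i
  obtain ⟨k, hk, hmax⟩ := exists_boundary_max w hnonneg B hB hconn f hharm
  obtain ⟨l, hl, hmin⟩ := exists_boundary_max w hnonneg B hB hconn (fun x => -f x) (by
    intro i hi
    rw [← neg_eq_zero, ← hharm i hi, ← Finset.sum_neg_distrib]
    exact Finset.sum_congr rfl fun j _ => by ring)
  exact ⟨(Finset.inf'_le f hl).trans (neg_le_neg_iff.1 (hmin i)),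
    (hmax i).trans (Finset.le_sup' f hk)⟩
end

section
/- Let V be a finite set, let w : V → V → ℝ be a symmetric weight function with w i j ≥ 0 for all i, j, and let B ⊆ V be a nonempty set of boundary vertices such that every vertex of V can be joined to some vertex of B by a path along edges of strictly positive weight. If f : V → ℝ² satisfies Σ_{j ∈ V} w i j · (f i − f j) = 0 at every vertex i ∉ B, then for every i ∈ V the value f i lies in the convex hull of the boundary values {f k : k ∈ B}. In particular, if all boundary values lie in a convex set D ⊆ ℝ² (such as the unit square), then the entire image of f lies in D. -/
open Finset

/-- Convex-hull maximum principle for discrete harmonic maps into `ℝ²`: every value of a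
discrete harmonic map lies in the convex hull of its boundary values; in particular, if all
boundary values lie in a convex set `D`, then the whole image lies in `D`. -/
theorem discrete_harmonic_map_convexHull
    {V : Type*} [Fintype V] (w : V → V → ℝ)
    (hsymm : ∀ i j, w i j = w j i) (hnonneg : ∀ i j, 0 ≤ w i j)
    (B : Finset V) (hB : B.Nonempty)
    (hconn : ∀ i : V, ∃ k ∈ B, Relation.ReflTransGen (fun a b => 0 < w a b) i k)
    (f : V → EuclideanSpace ℝ (Fin 2))
    (hharm : ∀ i : V, i ∉ B → ∑ j : V, w i j • (f i - f j) = 0) :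
    (∀ i : V, f i ∈ convexHull ℝ (f '' (B : Set V))) ∧
    (∀ D : Set (EuclideanSpace ℝ (Fin 2)), Convex ℝ D →
      (∀ k ∈ B, f k ∈ D) → ∀ i : V, f i ∈ D) := by
  have key : ∀ i : V, f i ∈ convexHull ℝ (f '' (B : Set V)) := by
    intro i
    by_contra hi
    have hfin : (f '' (B : Set V)).Finite := B.finite_toSet.image f
    obtain ⟨φ, u, hφ, hu⟩ := geometric_hahn_banach_closed_point
      (convex_convexHull ℝ (f '' (B : Set V))) (hfin.isClosed_convexHull (𝕜 := ℝ)) hi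
    have hb : ∀ k ∈ B, φ (f k) < u := fun k hk =>
      hφ _ (subset_convexHull ℝ _ ⟨k, hk, rfl⟩)
    obtain ⟨m, -, hm⟩ := Finset.exists_max_image Finset.univ (fun j => φ (f j)) ⟨i, mem_univ i⟩
    have hmax : ∀ j, φ (f j) ≤ φ (f m) := fun j => hm j (mem_univ j)
    have hum : u < φ (f m) := lt_of_lt_of_le hu (hmax i)
    obtain ⟨k, hk, hpath⟩ := hconn m
    have main : φ (f m) = φ (f m) → False := by
      refine Relation.ReflTransGen.head_induction_on
        (motive := fun a _ => φ (f a) = φ (f m) → False) hpath ?_ ?_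
      · intro h
        linarith [hb k hk]
      · intro a c hac _ ih h
        by_cases ha : a ∈ B
        · linarith [hb a ha]
        · apply ih
          have h1 := congrArg φ (hharm a ha)
          simp only [map_sum, map_smul, map_sub, map_zero, smul_eq_mul] at h1
          rw [Finset.sum_eq_zero_iff_of_nonneg (fun j _ =>
            mul_nonneg (hnonneg a j) (by linarith [hmax j]))] at h1
          rcases mul_eq_zero.mp (h1 c (mem_univ c)) with h2 | h2
          · exact absurd h2 hac.ne'
          · linarith
    exact main rfl
  refine ⟨key, fun D hD hBD i => convexHull_min ?_ hD (key i)⟩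
  rintro _ ⟨k, hk, rfl⟩
  exact hBD k hk
end

section
/- Let U ⊆ ℝ² be a bounded open set and let u, v : ℝ² → ℝ be twice continuously differentiable on a neighborhood of the closure of U, with u harmonic on U (Δu = 0 on U) and u = v on the frontier of U. Then ∫_U ‖∇u‖² ≤ ∫_U ‖∇v‖², i.e. the harmonic function minimizes the Dirichlet energy among all functions with the same boundary values. -/
open MeasureTheory

/-- The Laplacian of a function on the Euclidean plane, as the sum of the two pure second
partial derivatives in the coordinate directions. -/
noncomputable def planarLaplacian (u : EuclideanSpace ℝ (Fin 2) → ℝ)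
    (x : EuclideanSpace ℝ (Fin 2)) : ℝ :=
  ∑ i : Fin 2,
    fderiv ℝ (fun y => fderiv ℝ u y (EuclideanSpace.single i 1)) x (EuclideanSpace.single i 1)

abbrev E2 := EuclideanSpace ℝ (Fin 2)

lemma dir_int_zero (G : E2 → ℝ) (hG : ContDiff ℝ 1 G) (hc : HasCompactSupport G) (e : E2) :
    Integrable (fun x => fderiv ℝ G x e) ∧ ∫ x, fderiv ℝ G x e = 0 := by
  have hi : Integrable (fun x => fderiv ℝ G x e) := by
    apply Continuous.integrable_of_hasCompactSupport
    · exact (hG.continuous_fderiv (by norm_num)).clm_apply continuous_const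
    · exact hc.fderiv_apply ℝ e
  refine ⟨hi, ?_⟩
  have := integral_mul_fderiv_eq_neg_fderiv_mul_of_integrable (μ := (volume : Measure E2)) (f := fun _ => (1:ℝ)) (g := G) (v := e)
    (by simp) (by simpa using hi)
    (by simpa using hG.continuous.integrable_of_hasCompactSupport hc)
    (by fun_prop) (fun x _ => hG.differentiable (by norm_num) x)
  simpa using this

lemma ae_fderiv_zero (w : E2 → ℝ) (s : Set E2) (hs : MeasurableSet s)
    (hw : ∀ x ∈ s, DifferentiableAt ℝ w x) (h0 : ∀ x ∈ s, w x = 0) :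
    ∀ᵐ x ∂(volume.restrict s), fderiv ℝ w x = 0 := by
  set e : E2 := EuclideanSpace.single 0 1
  have he : ‖e‖ = 1 := by simp [e]
  have h : ApproximatesLinearOn (fun x => w x • e) (0 : E2 →L[ℝ] E2) s 0 := by
    intro x hx y hy
    simp [h0 x hx, h0 y hy]
  have := h.norm_fderiv_sub_le volume hs (fun x => (fderiv ℝ w x).smulRight e)
    (fun x hx => ((hw x hx).hasFDerivAt.smul_const e).hasFDerivWithinAt)
  filter_upwards [this] with x hx
  have : ‖(fderiv ℝ w x).smulRight e‖ = 0 := by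
    simpa using hx
  rw [ContinuousLinearMap.norm_smulRight_apply, he, mul_one, norm_eq_zero] at this
  exact this

/-- the cutoff derivative -/
noncomputable def hcut (n : ℕ) (t : ℝ) : ℝ := min 1 (max 0 ((n + 1) * |t| - 1))

noncomputable def pcut (n : ℕ) (t : ℝ) : ℝ := ∫ s in (0:ℝ)..t, hcut n s

lemma hcut_cont (n) : Continuous (hcut n) := by unfold hcut; fun_prop
lemma hcut_nonneg (n t) : 0 ≤ hcut n t := by unfold hcut; positivity
lemma hcut_le (n t) : hcut n t ≤ 1 := min_le_left _ _
lemma hcut_zero (n : ℕ) (t : ℝ) (ht : (n + 1) * |t| ≤ 1) : hcut n t = 0 := by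
  unfold hcut; rw [max_eq_left (by linarith)]; norm_num
lemma hcut_lim (t : ℝ) (ht : t ≠ 0) : Filter.Tendsto (fun n => hcut n t) Filter.atTop (nhds 1) := by
  apply tendsto_const_nhds.congr'
  obtain ⟨N, hN⟩ := exists_nat_gt (2 / |t|)
  filter_upwards [Filter.eventually_ge_atTop N] with n hn
  have h0 : 0 < |t| := abs_pos.mpr ht
  rw [div_lt_iff₀ h0] at hN
  have : (N:ℝ) ≤ n := by exact_mod_cast hn
  have : 2 ≤ ((n:ℝ) + 1) * |t| := by nlinarith
  unfold hcut
  rw [max_eq_right (by linarith), min_eq_left (by linarith)]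
lemma pcut_deriv (n t) : HasDerivAt (pcut n) (hcut n t) t :=
  ((hcut_cont n).integral_hasStrictDerivAt 0 t).hasDerivAt
lemma pcut_contDiff (n) : ContDiff ℝ 1 (pcut n) := by
  rw [contDiff_one_iff_deriv]
  refine ⟨fun t => (pcut_deriv n t).differentiableAt, ?_⟩
  have : deriv (pcut n) = hcut n := funext fun t => (pcut_deriv n t).deriv
  rw [this]; exact hcut_cont n
lemma pcut_zero (n : ℕ) (t : ℝ) (ht : (n + 1) * |t| ≤ 1) : pcut n t = 0 := by
  unfold pcut
  rw [intervalIntegral.integral_congr (g := fun _ => (0:ℝ))]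
  · simp
  · intro s hs
    apply hcut_zero
    have : |s| ≤ |t| := by
      simpa using Set.abs_sub_left_of_mem_uIcc hs
    have : (0:ℝ) ≤ n := by positivity
    nlinarith

lemma step (U O : Set E2) (hU : IsOpen U) (hb : Bornology.IsBounded U) (hO : IsOpen O)
    (hUO : closure U ⊆ O) (u w : E2 → ℝ) (hu : ContDiffOn ℝ 2 u O) (hw : ContDiffOn ℝ 2 w O)
    (hharm : ∀ x ∈ U, planarLaplacian u x = 0) (h0 : ∀ x ∈ frontier U, w x = 0) (n : ℕ) :
    ∫ x in U, hcut n (w x) * ∑ i : Fin 2, fderiv ℝ w x (EuclideanSpace.single i 1) *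
      fderiv ℝ u x (EuclideanSpace.single i 1) = 0 := by
  classical
  set e : Fin 2 → E2 := fun i => EuclideanSpace.single i 1 with he
  have hUO' : U ⊆ O := subset_closure.trans hUO
  set K : Set E2 := closure U ∩ {x | 1 ≤ (n + 1) * |w x|} with hK
  have hwc : ContinuousOn w (closure U) := hw.continuousOn.mono hUO
  have hKc : IsClosed K := by
    have : ContinuousOn (fun x => ((n:ℝ) + 1) * |w x|) (closure U) := by fun_prop
    exact this.preimage_isClosed_of_isClosed isClosed_closure isClosed_Ici
  have hKcomp : IsCompact K := hb.isCompact_closure.of_isClosed_subset hKc Set.inter_subset_left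
  have hKU : K ⊆ U := by
    rintro x ⟨hx, hx2⟩
    by_contra hxU
    have : x ∈ frontier U := by rw [hU.frontier_eq]; exact ⟨hx, hxU⟩
    simp only [Set.mem_setOf_eq, h0 x this] at hx2
    norm_num at hx2
  have hd1 : ∀ i, ∀ x ∈ U, ContDiffAt ℝ 1 (fun y => fderiv ℝ u y (e i)) x := by
    intro i x hx
    have h := hu.contDiffAt (hO.mem_nhds (hUO' hx))
    exact (h.fderiv_right (m := 1) (by norm_num)).clm_apply contDiffAt_const
  have hw1 : ∀ x ∈ U, ContDiffAt ℝ 1 w x := fun x hx =>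
    (hw.contDiffAt (hO.mem_nhds (hUO' hx))).of_le (by norm_num)
  let G : Fin 2 → E2 → ℝ := fun i => U.indicator (fun x => pcut n (w x) * fderiv ℝ u x (e i))
  have hG0 : ∀ i, ∀ x ∉ K, G i x = 0 := by
    intro i x hx
    by_cases hxU : x ∈ U
    · simp only [G, Set.indicator_of_mem hxU]
      rw [pcut_zero, zero_mul]
      by_contra hlt
      exact hx ⟨subset_closure hxU, by simpa using (not_le.mp hlt).le⟩
    · simp [G, hxU]
  have hGU : ∀ i, ∀ x ∈ U, G i =ᶠ[nhds x] fun x => pcut n (w x) * fderiv ℝ u x (e i) := by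
    intro i x hx
    filter_upwards [hU.mem_nhds hx] with y hy
    simp [G, hy]
  have hGK : ∀ i, ∀ x ∉ U, G i =ᶠ[nhds x] fun _ => 0 := by
    intro i x hx
    filter_upwards [hKc.isOpen_compl.mem_nhds (fun h => hx (hKU h))] with y hy
    exact hG0 i y hy
  have hGc : ∀ i, ContDiff ℝ 1 (G i) := by
    intro i
    rw [contDiff_iff_contDiffAt]
    intro x
    by_cases hx : x ∈ U
    · refine ContDiffAt.congr_of_eventuallyEq ?_ (hGU i x hx)
      exact ((pcut_contDiff n).contDiffAt.comp x (hw1 x hx)).mul (hd1 i x hx)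
    · exact contDiffAt_const.congr_of_eventuallyEq (hGK i x hx)
  have hGs : ∀ i, HasCompactSupport (G i) := fun i => HasCompactSupport.intro hKcomp (hG0 i)
  have hsum : ∫ x, ∑ i : Fin 2, fderiv ℝ (G i) x (e i) = 0 := by
    rw [integral_finsetSum _ (fun i _ => (dir_int_zero (G i) (hGc i) (hGs i) (e i)).1)]
    exact Finset.sum_eq_zero fun i _ => (dir_int_zero (G i) (hGc i) (hGs i) (e i)).2
  rw [← hsum, ← integral_indicator hU.measurableSet]
  congr 1
  ext x
  by_cases hx : x ∈ U
  · rw [Set.indicator_of_mem hx]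
    have hf : ∀ i, fderiv ℝ (G i) x (e i) = pcut n (w x) *
        fderiv ℝ (fun y => fderiv ℝ u y (e i)) x (e i) +
        hcut n (w x) * (fderiv ℝ w x (e i) * fderiv ℝ u x (e i)) := by
      intro i
      rw [(hGU i x hx).fderiv_eq]
      have h1 := (pcut_deriv n (w x)).comp_hasFDerivAt x
        ((hw1 x hx).differentiableAt (by norm_num)).hasFDerivAt
      have h2 := ((hd1 i x hx).differentiableAt (by norm_num)).hasFDerivAt
      have h3 := (h1.mul h2).fderiv
      simp only [Function.comp_def] at h3
      have h4 := congrArg (fun L : E2 →L[ℝ] ℝ => L (e i)) h3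
      refine h4.trans ?_
      simp
      ring
    have hh := hharm x hx
    simp only [planarLaplacian] at hh
    simp only [hf, Finset.sum_add_distrib, ← Finset.mul_sum]
    simp only [he]
    rw [hh]; simp
  · rw [Set.indicator_of_notMem hx]
    symm
    apply Finset.sum_eq_zero
    intro i _
    rw [(hGK i x hx).fderiv_eq]; simp

lemma cross_zero (U O : Set E2) (hU : IsOpen U) (hb : Bornology.IsBounded U) (hO : IsOpen O)
    (hUO : closure U ⊆ O) (u w : E2 → ℝ) (hu : ContDiffOn ℝ 2 u O) (hw : ContDiffOn ℝ 2 w O)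
    (hharm : ∀ x ∈ U, planarLaplacian u x = 0) (h0 : ∀ x ∈ frontier U, w x = 0)
    (hTint : IntegrableOn (fun x => ∑ i : Fin 2, fderiv ℝ w x (EuclideanSpace.single i 1) *
      fderiv ℝ u x (EuclideanSpace.single i 1)) U) :
    ∫ x in U, ∑ i : Fin 2, fderiv ℝ w x (EuclideanSpace.single i 1) *
      fderiv ℝ u x (EuclideanSpace.single i 1) = 0 := by
  set T : E2 → ℝ := fun x => ∑ i : Fin 2, fderiv ℝ w x (EuclideanSpace.single i 1) *
      fderiv ℝ u x (EuclideanSpace.single i 1) with hT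
  have hUO' : U ⊆ O := subset_closure.trans hUO
  have hwc : ContinuousOn w U := hw.continuousOn.mono hUO'
  have hlim : Filter.Tendsto (fun n => ∫ x in U, hcut n (w x) * T x) Filter.atTop
      (nhds (∫ x in U, T x)) := by
    apply tendsto_integral_of_dominated_convergence (fun x => ‖T x‖)
    · intro n
      refine AEStronglyMeasurable.mul ?_ hTint.aestronglyMeasurable
      exact ((hcut_cont n).comp_continuousOn hwc).aestronglyMeasurable hU.measurableSet
    · exact hTint.norm
    · intro n
      refine Filter.Eventually.of_forall fun x => ?_
      rw [norm_mul, Real.norm_of_nonneg (hcut_nonneg _ _)]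
      exact mul_le_of_le_one_left (norm_nonneg _) (hcut_le _ _)
    · have hZ : MeasurableSet (U ∩ w ⁻¹' {0}ᶜ) :=
        (hwc.isOpen_inter_preimage hU isOpen_compl_singleton).measurableSet
      have hS : MeasurableSet (U \ (U ∩ w ⁻¹' {0}ᶜ)) := hU.measurableSet.diff hZ
      have hae := ae_fderiv_zero w _ hS
        (fun x hx => (hw.contDiffAt (hO.mem_nhds (hUO' hx.1))).differentiableAt (by norm_num))
        (fun x hx => by
          by_contra h
          exact hx.2 ⟨hx.1, h⟩)
      rw [ae_restrict_iff' hS] at hae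
      rw [ae_restrict_iff' hU.measurableSet]
      filter_upwards [hae] with x hx hxU
      by_cases h : w x = 0
      · have : T x = 0 := by
          have hz := hx ⟨hxU, fun h' => h'.2 h⟩
          simp [hT, hz]
        simp [this]
      · simpa using (hcut_lim (w x) h).mul_const (T x)
  have hz : (fun n => ∫ x in U, hcut n (w x) * T x) = fun _ => 0 :=
    funext fun n => step U O hU hb hO hUO u w hu hw hharm h0 n
  rw [hz] at hlim
  exact (tendsto_nhds_unique hlim tendsto_const_nhds)

lemma grad_sq (f : E2 → ℝ) (x : E2) :
    ‖gradient f x‖ ^ 2 = ∑ i : Fin 2, fderiv ℝ f x (EuclideanSpace.single i 1) ^ 2 := by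
  rw [EuclideanSpace.norm_sq_eq]
  refine Finset.sum_congr rfl fun i _ => ?_
  rw [← inner_gradient_left, EuclideanSpace.inner_single_right]
  simp

/-- Dirichlet principle: a harmonic function minimizes the Dirichlet energy among all `C²`
functions with the same boundary values. -/
theorem harmonic_minimizes_dirichlet_energy
    (U : Set (EuclideanSpace ℝ (Fin 2))) (hUopen : IsOpen U)
    (hUbdd : Bornology.IsBounded U)
    (u v : EuclideanSpace ℝ (Fin 2) → ℝ)
    (hu : ∃ O : Set (EuclideanSpace ℝ (Fin 2)), IsOpen O ∧ closure U ⊆ O ∧ ContDiffOn ℝ 2 u O)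
    (hv : ∃ O : Set (EuclideanSpace ℝ (Fin 2)), IsOpen O ∧ closure U ⊆ O ∧ ContDiffOn ℝ 2 v O)
    (hharm : ∀ x ∈ U, planarLaplacian u x = 0)
    (hbdry : ∀ x ∈ frontier U, u x = v x) :
    ∫ x in U, ‖gradient u x‖ ^ 2 ≤ ∫ x in U, ‖gradient v x‖ ^ 2 := by
  obtain ⟨O₁, hO₁, hUO₁, hu⟩ := hu
  obtain ⟨O₂, hO₂, hUO₂, hv⟩ := hv
  set O := O₁ ∩ O₂
  have hO : IsOpen O := hO₁.inter hO₂
  have hUO : closure U ⊆ O := Set.subset_inter hUO₁ hUO₂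
  have hUO' : U ⊆ O := subset_closure.trans hUO
  replace hu : ContDiffOn ℝ 2 u O := hu.mono Set.inter_subset_left
  replace hv : ContDiffOn ℝ 2 v O := hv.mono Set.inter_subset_right
  set w : E2 → ℝ := fun x => v x - u x with hwdef
  have hw : ContDiffOn ℝ 2 w O := hv.sub hu
  have hD : ∀ f : E2 → ℝ, ContDiffOn ℝ 2 f O → ∀ e : E2,
      ContinuousOn (fun x => fderiv ℝ f x e) (closure U) := fun f hf e =>
    ((hf.continuousOn_fderiv_of_isOpen hO (by norm_num)).mono hUO).clm_apply continuousOn_const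
  have hI : ∀ g : E2 → ℝ, ContinuousOn g (closure U) → IntegrableOn g U := fun g hg =>
    (hg.integrableOn_compact hUbdd.isCompact_closure).mono_set subset_closure
  have hIT : IntegrableOn (fun x => ∑ i : Fin 2, fderiv ℝ w x (EuclideanSpace.single i 1) *
      fderiv ℝ u x (EuclideanSpace.single i 1)) U :=
    hI _ (continuousOn_finset_sum _ fun i _ => (hD w hw _).mul (hD u hu _))
  have hIu : IntegrableOn (fun x => ∑ i : Fin 2, fderiv ℝ u x (EuclideanSpace.single i 1) ^ 2) U :=
    hI _ (continuousOn_finset_sum _ fun i _ => (hD u hu _).pow 2)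
  have hIv : IntegrableOn (fun x => ∑ i : Fin 2, fderiv ℝ v x (EuclideanSpace.single i 1) ^ 2) U :=
    hI _ (continuousOn_finset_sum _ fun i _ => (hD v hv _).pow 2)
  have hc := cross_zero U O hUopen hUbdd hO hUO u w hu hw hharm
    (fun x hx => by simp [hwdef, hbdry x hx]) hIT
  simp only [grad_sq]
  have hle : ∫ x in U, ((∑ i : Fin 2, fderiv ℝ u x (EuclideanSpace.single i 1) ^ 2) +
      2 * ∑ i : Fin 2, fderiv ℝ w x (EuclideanSpace.single i 1) *
      fderiv ℝ u x (EuclideanSpace.single i 1)) ≤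
      ∫ x in U, ∑ i : Fin 2, fderiv ℝ v x (EuclideanSpace.single i 1) ^ 2 := by
    refine setIntegral_mono_on (hIu.add (hIT.const_mul 2)) hIv hUopen.measurableSet ?_
    intro x hx
    rw [Finset.mul_sum, ← Finset.sum_add_distrib]
    refine Finset.sum_le_sum fun i _ => ?_
    have hdu := (hu.contDiffAt (hO.mem_nhds (hUO' hx))).differentiableAt (by norm_num)
    have hdv := (hv.contDiffAt (hO.mem_nhds (hUO' hx))).differentiableAt (by norm_num)
    have : fderiv ℝ w x = fderiv ℝ v x - fderiv ℝ u x := fderiv_fun_sub hdv hdu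
    rw [this, ContinuousLinearMap.sub_apply]
    nlinarith [sq_nonneg (fderiv ℝ v x (EuclideanSpace.single i 1) -
      fderiv ℝ u x (EuclideanSpace.single i 1))]
  rw [integral_add hIu (hIT.const_mul 2), integral_const_mul, hc] at hle
  simpa using hle
end

section
/- Let D ⊆ ℝ² be a compact convex set with nonempty interior, and let u : ℂ → ℝ² be continuous on the closed unit disk, with both component functions harmonic on the open unit disk, such that the restriction of u to the unit circle is a homeomorphism onto the frontier of D. Then u restricted to the open unit disk is injective, and u maps the open unit disk homeomorphically onto the interior of D. -/
open Metric

/-- The Laplacian of a real-valued function on `ℂ`, as the sum of the two pure second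
partial derivatives in the directions `1` and `I`. -/
noncomputable def complexLaplacian (u : ℂ → ℝ) (z : ℂ) : ℝ :=
  fderiv ℝ (fun y => fderiv ℝ u y 1) z 1 +
    fderiv ℝ (fun y => fderiv ℝ u y Complex.I) z Complex.I

/-- A real-valued function is harmonic on an open set if it is twice continuously
differentiable there and its Laplacian vanishes. -/
def IsHarmonicOn (u : ℂ → ℝ) (U : Set ℂ) : Prop :=
  ContDiffOn ℝ 2 u U ∧ ∀ z ∈ U, complexLaplacian u z = 0

open InnerProductSpace Set Filter Topology

/-- strict positivity of circle averages -/
lemma rkc_avg_pos (h : ℂ → ℝ) (hc : ContinuousOn h (sphere (0:ℂ) 1))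
    (h0 : ∀ ζ ∈ sphere (0:ℂ) 1, 0 ≤ h ζ) (ζ₀ : ℂ) (hζ₀ : ζ₀ ∈ sphere (0:ℂ) 1) (hpos : 0 < h ζ₀) :
    0 < Real.circleAverage h 0 1 := by
  have hm : ∀ θ : ℝ, circleMap (0:ℂ) 1 θ ∈ sphere (0:ℂ) 1 :=
    fun θ => circleMap_mem_sphere _ zero_le_one _
  have hcont : Continuous (fun θ : ℝ => h (circleMap 0 1 θ)) := by
    rw [← continuousOn_univ]
    exact hc.comp (continuous_circleMap 0 1).continuousOn (fun θ _ => hm θ)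
  have him : ζ₀ ∈ circleMap (0:ℂ) 1 '' Ioc 0 (2 * Real.pi) := by
    rw [image_circleMap_Ioc]; simpa using hζ₀
  obtain ⟨θ, hθ, rfl⟩ := him
  unfold Real.circleAverage
  have : 0 < ∫ θ in (0:ℝ)..2 * Real.pi, h (circleMap 0 1 θ) := by
    apply intervalIntegral.integral_pos Real.two_pi_pos hcont.continuousOn
      (fun x _ => h0 _ (hm x)) ⟨θ, Ioc_subset_Icc_self hθ, hpos⟩
  have := Real.pi_pos
  rw [smul_eq_mul]
  positivity

lemma rkc_harm (u : ℂ → ℝ) (h : IsHarmonicOn u (ball (0:ℂ) 1)) :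
    HarmonicOnNhd u (ball (0:ℂ) 1) := by
  have key : ∀ z ∈ ball (0:ℂ) 1, ContDiffAt ℝ 2 u z ∧ (Laplacian.laplacian u) z = 0 := by
    intro z hz
    have hcd : ContDiffAt ℝ 2 u z := h.1.contDiffAt (isOpen_ball.mem_nhds hz)
    refine ⟨hcd, ?_⟩
    have h2 := h.2 z hz
    have hd : DifferentiableAt ℝ (fderiv ℝ u) z :=
      (hcd.fderiv_right (m := 1) (by norm_num)).differentiableAt (by norm_num)
    rw [laplacian_eq_iteratedFDeriv_complexPlane]
    simp only [iteratedFDeriv_two_apply]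
    unfold complexLaplacian at h2
    have e : ∀ w : ℂ, fderiv ℝ (fun y => fderiv ℝ u y w) z w = fderiv ℝ (fderiv ℝ u) z w w := by
      intro w
      rw [fderiv_clm_apply hd (differentiableAt_const w)]
      simp
    rw [e, e] at h2
    simpa using h2
  intro z hz
  refine ⟨(key z hz).1, ?_⟩
  filter_upwards [isOpen_ball.mem_nhds hz] with y hy
  exact (key y hy).2

lemma rkc_poisson (f : ℂ → ℝ) (hf : HarmonicContOnCl f (ball (0:ℂ) 1)) (z : ℂ)
    (hz : z ∈ ball (0:ℂ) 1) (t : ℝ) (ht : f z = t) :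
    Real.circleAverage (fun ζ => (f ζ - t) / ‖ζ - z‖ ^ 2) 0 1 = 0 := by
  have h1 : HarmonicContOnCl (f - fun _ => t) (ball (0:ℂ) 1) :=
    ⟨hf.1.sub (by simp), hf.2.sub continuousOn_const⟩
  have h2 := h1.circleAverage_poissonKernel_smul hz
  have hz' : ‖z‖ < 1 := by simpa using hz
  have hpos : (1 - ‖z‖ ^ 2) ≠ 0 := by nlinarith [norm_nonneg z]
  have e : Real.circleAverage (poissonKernel 0 z • (f - fun _ => t)) 0 1
      = Real.circleAverage ((1 - ‖z‖^2) • fun ζ => (f ζ - t) / ‖ζ - z‖ ^ 2) 0 1 := by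
    apply Real.circleAverage_congr_sphere
    intro ζ hζ
    have : ‖ζ‖ = 1 := by simpa using hζ
    simp [poissonKernel_def, this]
    ring
  rw [e, Real.circleAverage_smul] at h2
  simp [ht, hpos] at h2
  simpa using h2

/-- polar parametrisation of the frontier -/
lemma rkc_polar (D : Set ℂ) (hDc : IsCompact D) (hDconv : Convex ℝ D) (p : ℂ)
    (hp : p ∈ interior D) : ∃ ρ : ℂ → ℝ, ContinuousOn ρ {0}ᶜ ∧ (∀ v ≠ 0, 0 < ρ v) ∧
      (∀ v ≠ 0, p + ρ v • v ∈ frontier D) ∧ (∀ v, ∀ c > 0, ρ (c • v) = c⁻¹ * ρ v) ∧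
      (∀ x ∈ frontier D, x ≠ p ∧ ρ (x - p) = 1) := by
  set s : Set ℂ := (Homeomorph.addLeft p) ⁻¹' D with hs
  have hsconv : Convex ℝ s := hDconv.translate_preimage_right p
  have hs0 : s ∈ 𝓝 (0:ℂ) := by
    apply (Homeomorph.addLeft p).continuous.continuousAt
    simpa using mem_interior_iff_mem_nhds.1 hp
  have hsb : Bornology.IsBounded s := by
    have : IsCompact s := (Homeomorph.addLeft p).isCompact_preimage.2 hDc
    exact this.isBounded
  have hfr : ∀ x, x ∈ frontier s ↔ p + x ∈ frontier D := by
    intro x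
    rw [hs, ← Homeomorph.preimage_frontier]; rfl
  have hgpos : ∀ v ≠ 0, 0 < gauge s v := by
    intro v hv
    exact (gauge_pos (absorbent_nhds_zero hs0) ((NormedSpace.isVonNBounded_iff ℝ).2 hsb)).2 hv
  refine ⟨fun v => (gauge s v)⁻¹, ?_, ?_, ?_, ?_, ?_⟩
  · exact (continuous_gauge hsconv hs0).continuousOn.inv₀ (fun v hv => (hgpos v hv).ne')
  · intro v hv; exact inv_pos.2 (hgpos v hv)
  · intro v hv
    rw [← hfr, ← gauge_eq_one_iff_mem_frontier hsconv hs0,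
      gauge_smul_of_nonneg (inv_nonneg.2 (hgpos v hv).le)]
    simp [(hgpos v hv).ne']
  · intro v c hc
    simp only
    rw [gauge_smul_of_nonneg hc.le]; simp [mul_comm]
  · intro x hx
    refine ⟨fun h => ?_, ?_⟩
    · subst h; exact hx.2 hp
    · have : x - p ∈ frontier s := by rw [hfr]; simpa using hx
      rw [← gauge_eq_one_iff_mem_frontier hsconv hs0] at this
      simp [this]

/-- boundary parametrisation by directions -/
lemma rkc_param (D : Set ℂ) (hDc : IsCompact D) (hDconv : Convex ℝ D) (U : ℂ → ℂ)
    (hU : ContinuousOn U (closedBall (0:ℂ) 1)) (hb : BijOn U (sphere (0:ℂ) 1) (frontier D)) (p : ℂ)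
    (hp : p ∈ interior D) : ∃ γ : ℂ → ℂ, ContinuousOn γ {0}ᶜ ∧ (∀ v ≠ 0, γ v ∈ sphere (0:ℂ) 1) ∧
      (∀ v ≠ 0, ∃ r : ℝ, 0 < r ∧ U (γ v) = p + r • v) ∧
      (∀ v ≠ 0, ∀ c : ℝ, c > 0 → γ (c • v) = γ v) ∧
      (∀ ζ ∈ sphere (0:ℂ) 1, U ζ ≠ p ∧ γ (U ζ - p) = ζ) := by
  obtain ⟨ρ, h1, h2, h3, h4, h5⟩ := rkc_polar D hDc hDconv p hp
  have hUs : ContinuousOn U (sphere (0:ℂ) 1) := hU.mono sphere_subset_closedBall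
  let S := sphere (0:ℂ) 1
  have hinv : ContinuousOn (Function.invFunOn U S) (frontier D) := by
    rw [← hb.image_eq]
    have : ContinuousOn (Function.invFunOn U S) (U '' S) := by
      rw [continuousOn_iff_isClosed]
      intro t ht
      refine ⟨U '' (S ∩ t), ?_, ?_⟩
      · exact (((isCompact_sphere (0:ℂ) 1).inter_right ht).image_of_continuousOn
          (hUs.mono inter_subset_left)).isClosed
      · ext y
        constructor
        · rintro ⟨hy, x, hx, rfl⟩
          have := hb.injOn.leftInvOn_invFunOn hx
          refine ⟨⟨x, ⟨hx, ?_⟩, rfl⟩, ⟨x, hx, rfl⟩⟩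
          rwa [mem_preimage, this] at hy
        · rintro ⟨⟨x, ⟨hx, hxt⟩, rfl⟩, -⟩
          have := hb.injOn.leftInvOn_invFunOn hx
          refine ⟨?_, ⟨x, hx, rfl⟩⟩
          rw [mem_preimage, this]; exact hxt
    exact this
  have hr : ∀ y ∈ frontier D, Function.invFunOn U S y ∈ S ∧ U (Function.invFunOn U S y) = y := by
    intro y hy
    have hy' : ∃ a ∈ S, U a = y := hb.surjOn hy
    exact ⟨Function.invFunOn_mem hy', Function.invFunOn_eq hy'⟩
  refine ⟨fun v => Function.invFunOn U S (p + ρ v • v), ?_, ?_, ?_, ?_, ?_⟩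
  · exact hinv.comp (continuousOn_const.add (h1.smul continuousOn_id)) (fun v hv => h3 v hv)
  · intro v hv; exact (hr _ (h3 v hv)).1
  · intro v hv; exact ⟨ρ v, h2 v hv, (hr _ (h3 v hv)).2⟩
  · intro v hv c hc
    simp only [h4 v c hc]
    congr 2
    rw [smul_smul]; congr 1; field_simp
  · intro ζ hζ
    have h6 := h5 (U ζ) (hb.mapsTo hζ)
    refine ⟨h6.1, ?_⟩
    simp only [h6.2, one_smul]
    rw [add_sub_cancel]
    exact hb.injOn.leftInvOn_invFunOn hζ

/-- U maps the open disk to the interior -/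
lemma rkc_interior (D : Set ℂ) (hDc : IsCompact D) (hDconv : Convex ℝ D)
    (hDi : (interior D).Nonempty) (U : ℂ → ℂ)
    (hU : ContinuousOn U (closedBall (0:ℂ) 1)) (hH : HarmonicContOnCl U (ball (0:ℂ) 1))
    (hb : BijOn U (sphere (0:ℂ) 1) (frontier D)) (z : ℂ)
    (hz : z ∈ ball (0:ℂ) 1) : U z ∈ interior D := by
  by_contra hcon
  obtain ⟨f, hf⟩ := geometric_hahn_banach_open_point hDconv.interior isOpen_interior hcon
  obtain ⟨q, hq⟩ := hDi
  obtain ⟨γ, g1, g2, g3, g4, g5⟩ := rkc_param D hDc hDconv U hU hb q hq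
  have hle : ∀ x ∈ D, f x ≤ f (U z) := by
    intro x hx
    have hcl : x ∈ closure (interior D) := by
      rw [hDconv.closure_interior_eq_closure_of_nonempty_interior ⟨q, hq⟩]
      exact subset_closure hx
    exact le_on_closure (fun y hy => (hf y hy).le) f.continuous.continuousOn
      continuousOn_const hcl
  have hv : q - U z ≠ 0 := by
    intro h
    have := hf q hq
    rw [sub_eq_zero.1 h] at this
    exact lt_irrefl _ this
  obtain ⟨r, hr, hUr⟩ := g3 _ hv
  have hz' : ‖z‖ < 1 := by simpa using hz
  have hne : ∀ ζ ∈ sphere (0:ℂ) 1, 0 < ‖ζ - z‖ ^ 2 := by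
    intro ζ hζ
    have h1 : ‖ζ‖ = 1 := by simpa using hζ
    have : ζ - z ≠ 0 := by
      intro h; rw [sub_eq_zero.1 h] at h1; linarith
    positivity
  have hUs : ContinuousOn U (sphere (0:ℂ) 1) := hU.mono sphere_subset_closedBall
  have hP := rkc_poisson (-f ∘ U) (hH.comp_CLM (-f)) z hz (- f (U z)) (by simp)
  have := rkc_avg_pos (fun ζ => ((-f ∘ U) ζ - -f (U z)) / ‖ζ - z‖ ^ 2) ?_ ?_ _ (g2 _ hv) ?_
  · rw [hP] at this; exact lt_irrefl _ this
  · apply ContinuousOn.div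
    · exact ((-f).continuous.comp_continuousOn hUs).sub continuousOn_const
    · fun_prop
    · intro ζ hζ; exact (hne ζ hζ).ne'
  · intro ζ hζ
    apply div_nonneg _ (hne ζ hζ).le
    have := hle (U ζ) (hDc.isClosed.frontier_subset (hb.mapsTo hζ))
    simp; linarith
  · apply div_pos _ (hne _ (g2 _ hv))
    have h1 := hf q hq
    simp only [Function.comp, Pi.neg_apply, hUr, map_add, map_smul, map_sub, smul_eq_mul]
    nlinarith

lemma rkc_circle (z₁ z₂ a b : ℂ) (k : ℝ) (hz₁ : ‖z₁‖ < 1) (hz₂ : ‖z₂‖ < 1) (hne : z₁ ≠ z₂)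
    (ha : ‖a‖ = 1) (hb : ‖b‖ = 1) (hab : a ≠ b)
    (hSa : ‖a - z₂‖ ^ 2 = k * ‖a - z₁‖ ^ 2) (hSb : ‖b - z₂‖ ^ 2 = k * ‖b - z₁‖ ^ 2) :
    (∀ ζ : ℂ, ‖ζ‖ = 1 → ‖ζ - z₂‖ ^ 2 = k * ‖ζ - z₁‖ ^ 2 → ζ = a ∨ ζ = b) ∧
    (∃ ζ : ℂ, ‖ζ‖ = 1 ∧ 0 < ‖ζ - z₂‖ ^ 2 - k * ‖ζ - z₁‖ ^ 2) ∧
    (∃ ζ : ℂ, ‖ζ‖ = 1 ∧ ‖ζ - z₂‖ ^ 2 - k * ‖ζ - z₁‖ ^ 2 < 0) := by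
  set w : ℂ := z₂ - k * z₁ with hw
  set c : ℝ := 1 + ‖z₂‖ ^ 2 - k * (1 + ‖z₁‖ ^ 2) with hc
  have key : ∀ ζ : ℂ, ‖ζ‖ = 1 →
      ‖ζ - z₂‖ ^ 2 - k * ‖ζ - z₁‖ ^ 2 = c - 2 * ((starRingEnd ℂ) w * ζ).re := by
    intro ζ hζ
    have h1 : ‖ζ‖ ^ 2 = 1 := by rw [hζ]; norm_num
    rw [hc, hw]
    simp only [← Complex.normSq_eq_norm_sq, Complex.normSq_apply] at h1 ⊢
    simp
    linear_combination (1 - k) * h1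
  have hw0 : w ≠ 0 := by
    intro h0
    have h1 := key a ha
    rw [h0] at h1
    simp only [map_zero, zero_mul, Complex.zero_re, mul_zero, sub_zero] at h1
    have h2 : z₂ = k * z₁ := by rw [hw] at h0; exact sub_eq_zero.1 h0
    have h3 : ‖z₂‖ ^ 2 = k ^ 2 * ‖z₁‖ ^ 2 := by rw [h2]; simp [mul_pow]
    have h4 : (1 - k) * (1 - k * ‖z₁‖ ^ 2) = 0 := by
      linear_combination (-h1 + hSa) - h3 + hc
    rcases mul_eq_zero.1 h4 with h5 | h5
    · apply hne
      have : k = 1 := by linarith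
      rw [h2, this]; simp
    · have h6 : ‖z₂‖ ^ 2 = k := by rw [h3]; linear_combination (-k) * h5
      have := norm_nonneg z₁
      have := norm_nonneg z₂
      have hk1 : k < 1 := by rw [← h6]; nlinarith
      have hk0 : 0 ≤ k := by rw [← h6]; positivity
      have hn : ‖z₁‖ ^ 2 ≤ 1 := by nlinarith
      have := mul_le_mul_of_nonneg_left hn hk0
      linarith
  have hwn : 0 < ‖w‖ := norm_pos_iff.2 hw0
  have hcw : (starRingEnd ℂ) w ≠ 0 := by simpa using hw0
  have hsq : ∀ ζ : ℂ, ‖ζ‖ = 1 →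
      ((starRingEnd ℂ) w * ζ).re ^ 2 + ((starRingEnd ℂ) w * ζ).im ^ 2 = ‖w‖ ^ 2 := by
    intro ζ hζ
    have : ‖(starRingEnd ℂ) w * ζ‖ ^ 2 = ‖w‖ ^ 2 := by simp [hζ]
    rw [← this, ← Complex.normSq_eq_norm_sq, Complex.normSq_apply]; ring
  have ra : ((starRingEnd ℂ) w * a).re = c / 2 := by have := key a ha; linarith
  have rb : ((starRingEnd ℂ) w * b).re = c / 2 := by have := key b hb; linarith
  have sa := hsq a ha
  have sb := hsq b hb
  rw [ra] at sa
  rw [rb] at sb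
  have hext : ∀ x y : ℂ, ((starRingEnd ℂ) w * x).re = ((starRingEnd ℂ) w * y).re →
      ((starRingEnd ℂ) w * x).im = ((starRingEnd ℂ) w * y).im → x = y := by
    intro x y h1 h2
    exact mul_left_cancel₀ hcw (Complex.ext h1 h2)
  have hABim : ((starRingEnd ℂ) w * a).im ≠ ((starRingEnd ℂ) w * b).im :=
    fun h => hab (hext a b (ra.trans rb.symm) h)
  have hlt : (c / 2) ^ 2 < ‖w‖ ^ 2 := by
    by_contra h
    have h1 : ((starRingEnd ℂ) w * a).im ^ 2 = 0 := by
      have := sq_nonneg ((starRingEnd ℂ) w * a).im; linarith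
    have h2 : ((starRingEnd ℂ) w * b).im ^ 2 = 0 := by
      have := sq_nonneg ((starRingEnd ℂ) w * b).im; linarith
    rw [pow_eq_zero_iff two_ne_zero] at h1 h2
    exact hABim (h1.trans h2.symm)
  have habs := abs_lt_of_sq_lt_sq' hlt hwn.le
  have hval : ((starRingEnd ℂ) w * (w / ‖w‖)).re = ‖w‖ := by
    have : (starRingEnd ℂ) w * (w / ‖w‖) = ((‖w‖ : ℝ) : ℂ) := by
      rw [mul_div_assoc', mul_comm, Complex.mul_conj, Complex.normSq_eq_norm_sq]
      have : (‖w‖ : ℂ) ≠ 0 := by simpa using hw0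
      push_cast
      field_simp
    rw [this, Complex.ofReal_re]
  have hn1 : ‖w / (‖w‖ : ℂ)‖ = 1 := by simp [hw0]
  refine ⟨?_, ⟨-(w / ‖w‖), ?_, ?_⟩, ⟨w / ‖w‖, hn1, ?_⟩⟩
  · intro ζ hζ h
    have rz : ((starRingEnd ℂ) w * ζ).re = c / 2 := by have := key ζ hζ; linarith
    have sz := hsq ζ hζ
    rw [rz] at sz
    have e1 : ((starRingEnd ℂ) w * ζ).im ^ 2 = ((starRingEnd ℂ) w * a).im ^ 2 := by linarith
    have e2 : ((starRingEnd ℂ) w * a).im ^ 2 = ((starRingEnd ℂ) w * b).im ^ 2 := by linarith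
    rcases sq_eq_sq_iff_eq_or_eq_neg.1 e1 with h1 | h1
    · left; exact hext _ _ (rz.trans ra.symm) h1
    · rcases sq_eq_sq_iff_eq_or_eq_neg.1 e2 with h2 | h2
      · exact absurd h2 hABim
      · right; exact hext _ _ (rz.trans rb.symm) (by rw [h1, h2, neg_neg])
  · rw [norm_neg, hn1]
  · rw [key _ (by rw [norm_neg, hn1]), mul_neg, Complex.neg_re, hval]; linarith [habs.1]
  · rw [key _ hn1, hval]; linarith [habs.2]

lemma rkc_inj (D : Set ℂ) (hDc : IsCompact D) (hDconv : Convex ℝ D) (U : ℂ → ℂ)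
    (hU : ContinuousOn U (closedBall (0:ℂ) 1)) (hH : HarmonicContOnCl U (ball (0:ℂ) 1))
    (hb : BijOn U (sphere (0:ℂ) 1) (frontier D)) (z₁ z₂ p : ℂ)
    (hz₁ : z₁ ∈ ball (0:ℂ) 1) (hz₂ : z₂ ∈ ball (0:ℂ) 1) (hp : p ∈ interior D)
    (h₁ : U z₁ = p) (h₂ : U z₂ = p) : z₁ = z₂ := by
  by_contra hne
  obtain ⟨γ, g1, g2, g3, g4, g5⟩ := rkc_param D hDc hDconv U hU hb p hp
  have hpos : ∀ z ∈ ball (0:ℂ) 1, ∀ ζ ∈ sphere (0:ℂ) 1, 0 < ‖ζ - z‖ ^ 2 := by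
    intro z hz ζ hζ
    have hz' : ‖z‖ < 1 := by simpa using hz
    have h1 : ‖ζ‖ = 1 := by simpa using hζ
    have : ζ - z ≠ 0 := by
      intro h; rw [sub_eq_zero.1 h] at h1; linarith
    positivity
  have hP₁ := hpos z₁ hz₁
  have hP₂ := hpos z₂ hz₂
  have hUs : ContinuousOn U (sphere (0:ℂ) 1) := hU.mono sphere_subset_closedBall
  set R : ℂ → ℝ := fun ζ => ‖ζ - z₂‖ ^ 2 / ‖ζ - z₁‖ ^ 2 with hR
  have hRc : ContinuousOn R (sphere (0:ℂ) 1) := by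
    apply ContinuousOn.div (by fun_prop) (by fun_prop)
    intro ζ hζ; exact (hP₁ ζ hζ).ne'
  have hneg : ContinuousOn (fun v : ℂ => γ (-v)) {0}ᶜ :=
    g1.comp continuous_neg.continuousOn (fun v hv => by simpa using hv)
  have hHc : ContinuousOn (fun v => R (γ v) - R (γ (-v))) {0}ᶜ :=
    (hRc.comp g1 (fun v hv => g2 v hv)).sub
      (hRc.comp hneg (fun v hv => g2 (-v) (by simpa using hv)))
  have hconn : IsPreconnected ({0}ᶜ : Set ℂ) :=
    (isConnected_compl_singleton_of_one_lt_rank (by simp) 0).isPreconnected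
  have hex : ∃ v₀ : ℂ, v₀ ≠ 0 ∧ R (γ v₀) = R (γ (-v₀)) := by
    have hIV := hconn.image _ hHc
    have hmem : (0:ℝ) ∈ (fun v => R (γ v) - R (γ (-v))) '' {0}ᶜ := by
      have m1 : R (γ 1) - R (γ (-1)) ∈ (fun v => R (γ v) - R (γ (-v))) '' {0}ᶜ :=
        ⟨1, by simp, rfl⟩
      have m2 : R (γ (-1)) - R (γ 1) ∈ (fun v => R (γ v) - R (γ (-v))) '' {0}ᶜ :=
        ⟨-1, by simp, by simp⟩
      rcases le_total (R (γ 1)) (R (γ (-1))) with h | h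
      · exact hIV.ordConnected.out m1 m2 ⟨by linarith, by linarith⟩
      · exact hIV.ordConnected.out m2 m1 ⟨by linarith, by linarith⟩
    obtain ⟨v, hv, hv'⟩ := hmem
    exact ⟨v, hv, sub_eq_zero.1 hv'⟩
  obtain ⟨v₀, hv₀, hRR⟩ := hex
  have hnv₀ : -v₀ ≠ 0 := by simpa using hv₀
  set a := γ v₀ with ha
  set b := γ (-v₀) with hb'
  have has := g2 v₀ hv₀
  have hbs := g2 (-v₀) hnv₀
  obtain ⟨ra, hra, hUa⟩ := g3 v₀ hv₀
  obtain ⟨rb, hrb, hUb⟩ := g3 (-v₀) hnv₀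
  rw [← ha] at has hUa
  rw [← hb'] at hbs hUb
  have hab : a ≠ b := by
    intro h
    rw [← h, hUa] at hUb
    have h1 : (ra + rb) • v₀ = 0 := by
      rw [add_smul]
      have := add_left_cancel hUb
      rw [this]; simp
    rcases smul_eq_zero.1 h1 with h2 | h2
    · linarith
    · exact hv₀ h2
  set k := R a with hk
  have hSa : ‖a - z₂‖ ^ 2 = k * ‖a - z₁‖ ^ 2 := by
    have := (hP₁ a has).ne'
    rw [hk, hR]; exact (div_mul_cancel₀ _ this).symm
  have hSb : ‖b - z₂‖ ^ 2 = k * ‖b - z₁‖ ^ 2 := by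
    have := (hP₁ b hbs).ne'
    rw [hRR, hR]; exact (div_mul_cancel₀ _ this).symm
  obtain ⟨c1, ⟨ζp, hζp, hSp⟩, ⟨ζm, hζm, hSm⟩⟩ := rkc_circle z₁ z₂ a b k (by simpa using hz₁)
    (by simpa using hz₂) hne (by simpa using has) (by simpa using hbs) hab hSa hSb
  set S : ℂ → ℝ := fun ζ => ‖ζ - z₂‖ ^ 2 - k * ‖ζ - z₁‖ ^ 2 with hS
  have hSc : Continuous S := by fun_prop
  set f : ℂ →L[ℝ] ℝ := Complex.imCLM.comp
    ((ContinuousLinearMap.mul ℝ ℂ) ((starRingEnd ℂ) v₀)) with hf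
  have hfv : ∀ v, f v = ((starRingEnd ℂ) v₀ * v).im := fun v => by simp [hf]
  have hfv₀ : f v₀ = 0 := by rw [hfv]; simp; ring
  have hfker : ∀ v, f v = 0 → ∃ t : ℝ, v = t • v₀ := by
    intro v hv
    rw [hfv] at hv
    refine ⟨((starRingEnd ℂ) v₀ * v).re / ‖v₀‖ ^ 2, ?_⟩
    have hn : (‖v₀‖ : ℂ) ≠ 0 := by simpa using hv₀
    have h1 : (starRingEnd ℂ) v₀ * v = ((((starRingEnd ℂ) v₀ * v).re : ℝ) : ℂ) :=
      Complex.ext (by simp) (by rw [hv]; simp)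
    have h2 : v * (‖v₀‖:ℂ) ^ 2 = (((starRingEnd ℂ) v₀ * v).re : ℝ) * v₀ := by
      rw [← h1, ← Complex.ofReal_pow, ← Complex.normSq_eq_norm_sq, ← Complex.mul_conj]; ring
    rw [Complex.real_smul, Complex.ofReal_div, div_mul_eq_mul_div, ← h2]
    push_cast
    field_simp
  -- points on the circle off the line
  have hoff : ∀ ζ ∈ sphere (0:ℂ) 1, S ζ ≠ 0 → f (U ζ - p) ≠ 0 := by
    intro ζ hζ hSζ h0
    obtain ⟨t, ht⟩ := hfker _ h0
    obtain ⟨g6, g7⟩ := g5 ζ hζ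
    rw [ht] at g7
    have ht0 : t ≠ 0 := by
      rintro rfl
      simp at ht
      exact g6 (sub_eq_zero.1 ht)
    rcases lt_or_gt_of_ne ht0 with h | h
    · have := g4 (-v₀) hnv₀ (-t) (by linarith)
      rw [neg_smul_neg, g7] at this
      apply hSζ
      rw [this, ← hb', hS]; simp only; linarith
    · have := g4 v₀ hv₀ t h
      rw [g7] at this
      apply hSζ
      rw [this, ← ha, hS]; simp only; linarith
  have hSγ : ∀ v, f v ≠ 0 → S (γ v) ≠ 0 := by
    intro v hv h0
    have hv0 : v ≠ 0 := by rintro rfl; simp at hv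
    obtain ⟨r, hr, hUr⟩ := g3 v hv0
    have h1 : U (γ v) - p = r • v := by rw [hUr]; ring
    have h2 : f (U (γ v) - p) ≠ 0 := by
      rw [h1, map_smul, smul_eq_mul]; exact mul_ne_zero hr.ne' hv
    apply h2
    rcases c1 (γ v) (by simpa using g2 v hv0) (by rw [hS] at h0; simp only at h0; linarith)
      with h | h
    · rw [h, hUa, add_sub_cancel_left, map_smul, hfv₀, smul_zero]
    · rw [h, hUb, add_sub_cancel_left, map_smul, map_neg, hfv₀, neg_zero, smul_zero]
  have hsign : ∀ C : Set ℂ, Convex ℝ C → (∀ v ∈ C, f v ≠ 0) → ∀ ζ ∈ sphere (0:ℂ) 1,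
      ∀ ξ ∈ sphere (0:ℂ) 1, U ζ - p ∈ C → U ξ - p ∈ C → 0 < S ζ → S ξ < 0 → False := by
    intro C hC hCf ζ hζ ξ hξ hζC hξC hSζ hSξ
    have hcont : ContinuousOn (fun v => S (γ v)) C :=
      hSc.comp_continuousOn (g1.mono (fun v hv => by
        intro h
        rw [mem_singleton_iff] at h
        apply hCf v hv; rw [h]; simp))
    have hI := hC.isPreconnected.image _ hcont
    have m1 : S ζ ∈ (fun v => S (γ v)) '' C := ⟨U ζ - p, hζC, by simp only [(g5 ζ hζ).2]⟩
    have m2 : S ξ ∈ (fun v => S (γ v)) '' C := ⟨U ξ - p, hξC, by simp only [(g5 ξ hξ).2]⟩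
    obtain ⟨v, hv, hv'⟩ := hI.ordConnected.out m2 m1 ⟨hSξ.le, hSζ.le⟩
    exact hSγ v (hCf v hv) hv'
  have hζps : ζp ∈ sphere (0:ℂ) 1 := by simpa using hζp
  have hζms : ζm ∈ sphere (0:ℂ) 1 := by simpa using hζm
  have hfp := hoff ζp hζps hSp.ne'
  have hfm := hoff ζm hζms hSm.ne
  -- the main contradiction
  have main : ∀ g : ℂ →L[ℝ] ℝ, (∀ v, f v ≠ 0 ↔ g v ≠ 0) → 0 < g (U ζp - p) → False := by
    intro g hg hgp
    have cpos : Convex ℝ {v | 0 < g v} := convex_halfSpace_gt g.isLinear 0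
    have cneg : Convex ℝ {v | g v < 0} := convex_halfSpace_lt g.isLinear 0
    have hgm : g (U ζm - p) < 0 := by
      rcases lt_or_gt_of_ne ((hg _).1 hfm) with h | h
      · exact h
      · exact (hsign _ cpos (fun v hv => (hg v).2 (ne_of_gt hv)) ζp hζps ζm hζms hgp h hSp hSm).elim
    have hA₁ := rkc_poisson (g ∘ U) (hH.comp_CLM g) z₁ hz₁ (g p) (by simp [h₁])
    have hA₂ := rkc_poisson (g ∘ U) (hH.comp_CLM g) z₂ hz₂ (g p) (by simp [h₂])
    have hgU : ContinuousOn (fun ζ => (g ∘ U) ζ - g p) (sphere (0:ℂ) 1) :=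
      (g.continuous.comp_continuousOn hUs).sub continuousOn_const
    have hC₁ : ContinuousOn (fun ζ => ((g ∘ U) ζ - g p) / ‖ζ - z₁‖ ^ 2) (sphere (0:ℂ) 1) :=
      hgU.div (by fun_prop) (fun ζ hζ => (hP₁ ζ hζ).ne')
    have hC₂ : ContinuousOn (fun ζ => ((g ∘ U) ζ - g p) / ‖ζ - z₂‖ ^ 2) (sphere (0:ℂ) 1) :=
      hgU.div (by fun_prop) (fun ζ hζ => (hP₂ ζ hζ).ne')
    have hC₃ : ContinuousOn (k • fun ζ => ((g ∘ U) ζ - g p) / ‖ζ - z₂‖ ^ 2) (sphere (0:ℂ) 1) :=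
      hC₂.const_smul k
    have hpoint : ∀ ζ ∈ sphere (0:ℂ) 1,
        ((fun ζ => ((g ∘ U) ζ - g p) / ‖ζ - z₁‖ ^ 2) -
          (k • fun ζ => ((g ∘ U) ζ - g p) / ‖ζ - z₂‖ ^ 2)) ζ =
        (g (U ζ - p) * S ζ) / (‖ζ - z₁‖ ^ 2 * ‖ζ - z₂‖ ^ 2) := by
      intro ζ hζ
      have e1 := (hP₁ ζ hζ).ne'
      have e2 := (hP₂ ζ hζ).ne'
      simp only [Pi.sub_apply, Pi.smul_apply, smul_eq_mul, Function.comp, map_sub, hS]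
      generalize ‖ζ - z₁‖ ^ 2 = X at *
      generalize ‖ζ - z₂‖ ^ 2 = Y at *
      field_simp
    have := rkc_avg_pos _ (hC₁.sub hC₃) ?_ ζp hζps ?_
    · rw [Real.circleAverage_sub (hC₁.circleIntegrable zero_le_one)
        (hC₃.circleIntegrable zero_le_one), Real.circleAverage_smul, hA₁, hA₂] at this
      simp at this
    · intro ζ hζ
      rw [hpoint ζ hζ]
      apply div_nonneg _ (mul_pos (hP₁ ζ hζ) (hP₂ ζ hζ)).le
      rcases lt_trichotomy (S ζ) 0 with h | h | h
      · have h2 := (hg _).1 (hoff ζ hζ h.ne)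
        rcases lt_or_gt_of_ne h2 with h3 | h3
        · exact (mul_pos_of_neg_of_neg h3 h).le
        · exact (hsign _ cpos (fun v hv => (hg v).2 (ne_of_gt hv)) ζp hζps ζ hζ hgp h3 hSp h).elim
      · simp [h]
      · have h2 := (hg _).1 (hoff ζ hζ h.ne')
        rcases lt_or_gt_of_ne h2 with h3 | h3
        · exact (hsign _ cneg (fun v hv => (hg v).2 (ne_of_lt hv)) ζ hζ ζm hζms h3 hgm h hSm).elim
        · exact (mul_pos h3 h).le
    · rw [hpoint ζp hζps]
      exact div_pos (mul_pos hgp hSp) (mul_pos (hP₁ _ hζps) (hP₂ _ hζps))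
  rcases lt_or_gt_of_ne hfp with h | h
  · exact main (-f) (fun v => by simp) (by simpa using h)
  · exact main f (fun v => Iff.rfl) h

lemma rkc_surj (D : Set ℂ) (hDc : IsCompact D) (hDconv : Convex ℝ D) (U : ℂ → ℂ)
    (hU : ContinuousOn U (closedBall (0:ℂ) 1))
    (hb : BijOn U (sphere (0:ℂ) 1) (frontier D)) (q : ℂ) (hq : q ∈ interior D) :
    ∃ z ∈ closedBall (0:ℂ) 1, U z = q := by
  by_contra! hcon
  obtain ⟨γ, g1, g2, g3, g4, g5⟩ := rkc_param D hDc hDconv U hU hb q hq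
  set ret : ℂ → ℂ := fun z => ((max 1 ‖z‖)⁻¹ : ℝ) • z with hret
  have hmax : ∀ z : ℂ, 0 < max 1 ‖z‖ := fun z => lt_of_lt_of_le one_pos (le_max_left _ _)
  have hretc : Continuous ret := by
    refine Continuous.smul (f := fun z : ℂ => (max 1 ‖z‖)⁻¹) ?_ continuous_id
    exact (continuous_const.max continuous_norm).inv₀ (fun z => (hmax z).ne')
  have hretm : ∀ z, ret z ∈ closedBall (0:ℂ) 1 := by
    intro z
    simp only [hret, mem_closedBall_zero_iff, norm_smul, norm_inv, Real.norm_eq_abs,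
      abs_of_pos (hmax z)]
    rw [inv_mul_le_iff₀ (hmax z), mul_one]
    exact le_max_right _ _
  have hrets : ∀ z ∈ sphere (0:ℂ) 1, ret z = z := by
    intro z hz
    have : ‖z‖ = 1 := by simpa using hz
    simp [hret, this]
  have hgc : Continuous (fun z => U (ret z) - q) :=
    (hU.comp_continuous hretc hretm).sub continuous_const
  have hsc : IsSimplyConnected (univ : Set ℂ) := by
    have : ContractibleSpace (univ : Set ℂ) :=
      (convex_univ (𝕜 := ℝ) (E := ℂ)).contractibleSpace univ_nonempty
    exact SimplyConnectedSpace.ofContractible _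
  obtain ⟨L, hLc, hL⟩ := Complex.exists_continuousOn_eqOn_exp_comp (U := (univ : Set ℂ))
    (g := fun z => U (ret z) - q) hsc isOpen_univ hgc.continuousOn (by
      rintro ⟨z, -, hz⟩
      exact hcon _ (hretm z) (sub_eq_zero.1 hz))
  have hLγ : ∀ v ≠ 0, ∃ r : ℝ, 0 < r ∧ Complex.exp (L (γ v)) = r • v := by
    intro v hv
    obtain ⟨r, hr, h⟩ := g3 v hv
    refine ⟨r, hr, ?_⟩
    have := hL (mem_univ (γ v))
    simp only [Function.comp] at this
    rw [this, hrets _ (g2 v hv), h]; ring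
  have hLc' : Continuous L := continuousOn_univ.1 hLc
  have hneg : ContinuousOn (fun v : ℂ => γ (-v)) {0}ᶜ :=
    g1.comp continuous_neg.continuousOn (fun v hv => by simpa using hv)
  set d : ℂ → ℝ := fun v => (L (γ v)).im - (L (γ (-v))).im with hd
  have hdc : ContinuousOn d {0}ᶜ :=
    (Complex.continuous_im.comp_continuousOn (hLc'.comp_continuousOn g1)).sub
      (Complex.continuous_im.comp_continuousOn (hLc'.comp_continuousOn hneg))
  have hconn : IsPreconnected ({0}ᶜ : Set ℂ) :=
    (isConnected_compl_singleton_of_one_lt_rank (by simp) 0).isPreconnected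
  have hIV := hconn.image _ hdc
  have hmem : (0:ℝ) ∈ d '' {0}ᶜ := by
    have m1 : d 1 ∈ d '' {0}ᶜ := ⟨1, by simp, rfl⟩
    have m2 : -d 1 ∈ d '' {0}ᶜ := ⟨-1, by simp, by simp [hd]⟩
    rcases le_total (d 1) 0 with h | h
    · exact hIV.ordConnected.out m1 m2 ⟨by linarith, by linarith⟩
    · exact hIV.ordConnected.out m2 m1 ⟨by linarith, by linarith⟩
  obtain ⟨v, hv, hv0⟩ := hmem
  have hv' : v ≠ 0 := hv
  obtain ⟨r, hr, e1⟩ := hLγ v hv'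
  obtain ⟨s, hs, e2⟩ := hLγ (-v) (by simpa using hv')
  have him : (L (γ v)).im = (L (γ (-v))).im := sub_eq_zero.1 hv0
  have hsub : L (γ v) = L (γ (-v)) + (((L (γ v)).re - (L (γ (-v))).re : ℝ) : ℂ) :=
    Complex.ext (by simp) (by simp [him])
  rw [hsub, Complex.exp_add, e2, ← Complex.ofReal_exp] at e1
  set t := Real.exp ((L (γ v)).re - (L (γ (-v))).re) with ht
  have htp : 0 < t := Real.exp_pos _
  have : (r + s * t) • v = 0 := by
    simp only [Complex.real_smul] at e1 ⊢
    push_cast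
    linear_combination (-1 : ℂ) * e1
  rcases smul_eq_zero.1 this with h | h
  · have := mul_pos hs htp; linarith
  · exact hv' h

/-- Radó–Kneser–Choquet theorem: a planar harmonic map of the closed unit disk whose
boundary restriction is a homeomorphism onto the frontier of a compact convex set `D`
with nonempty interior is injective on the open disk and maps it homeomorphically onto
the interior of `D`. -/
theorem rado_kneser_choquet
    (D : Set (EuclideanSpace ℝ (Fin 2))) (hDcompact : IsCompact D) (hDconv : Convex ℝ D)
    (hDint : (interior D).Nonempty)
    (u : ℂ → EuclideanSpace ℝ (Fin 2))
    (hu_cont : ContinuousOn u (closedBall (0 : ℂ) 1))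
    (hu_harm : ∀ i : Fin 2, IsHarmonicOn (fun z => u z i) (ball (0 : ℂ) 1))
    (hu_bdry : Set.BijOn u (sphere (0 : ℂ) 1) (frontier D)) :
    Set.InjOn u (ball (0 : ℂ) 1) ∧
    ∃ e : (ball (0 : ℂ) 1) ≃ₜ (interior D),
      ∀ z : (ball (0 : ℂ) 1), (e z : EuclideanSpace ℝ (Fin 2)) = u z := by
  set L : EuclideanSpace ℝ (Fin 2) ≃L[ℝ] ℂ :=
    Complex.orthonormalBasisOneI.repr.symm.toContinuousLinearEquiv with hL
  have hLa : ∀ x, L x = (x 0 : ℂ) + (x 1 : ℂ) * Complex.I := by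
    intro x
    have h : L x = Complex.orthonormalBasisOneI.repr.symm x := rfl
    rw [h, ← Complex.orthonormalBasisOneI.sum_repr_symm]
    simp
  set U : ℂ → ℂ := fun z => L (u z) with hUdef
  set E : Set ℂ := L '' D with hE
  have hEc : IsCompact E := hDcompact.image L.continuous
  have hEconv : Convex ℝ E := hDconv.linear_image L.toLinearEquiv.toLinearMap
  have hEint : interior E = L '' interior D := (L.toHomeomorph.image_interior D).symm
  have hEfr : frontier E = L '' frontier D := (L.toHomeomorph.image_frontier D).symm
  have hEi : (interior E).Nonempty := by rw [hEint]; exact hDint.image _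
  have hU : ContinuousOn U (closedBall (0:ℂ) 1) := L.continuous.comp_continuousOn hu_cont
  have hHN : HarmonicOnNhd U (ball (0:ℂ) 1) := by
    have e0 := (rkc_harm _ (hu_harm 0)).comp_CLM Complex.ofRealCLM
    have e1 := (rkc_harm _ (hu_harm 1)).comp_CLM
      (((ContinuousLinearMap.mul ℝ ℂ) Complex.I).comp Complex.ofRealCLM)
    have e2 := e0.add e1
    have : U = ((⇑Complex.ofRealCLM ∘ fun z => u z 0) +
        (⇑(((ContinuousLinearMap.mul ℝ ℂ) Complex.I).comp Complex.ofRealCLM) ∘ fun z => u z 1)) := by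
      funext z
      simp [hUdef, hLa, mul_comm]
    rw [this]; exact e2
  have hH : HarmonicContOnCl U (ball (0:ℂ) 1) :=
    ⟨hHN, by rw [closure_ball _ one_ne_zero]; exact hU⟩
  have hb : Set.BijOn U (sphere (0:ℂ) 1) (frontier E) := by
    rw [hEfr]
    exact (L.injective.injOn.bijOn_image).comp hu_bdry
  have hmaps : ∀ z ∈ ball (0:ℂ) 1, u z ∈ interior D := by
    intro z hz
    have := rkc_interior E hEc hEconv hEi U hU hH hb z hz
    rw [hEint] at this
    obtain ⟨x, hx, hxe⟩ := this
    rw [← L.injective hxe]; exact hx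
  have hinj : Set.InjOn u (ball (0:ℂ) 1) := by
    intro z₁ hz₁ z₂ hz₂ h
    refine rkc_inj E hEc hEconv U hU hH hb z₁ z₂ (U z₁) hz₁ hz₂
      (rkc_interior E hEc hEconv hEi U hU hH hb z₁ hz₁) rfl ?_
    simp only [hUdef, h]
  have hdisj : ∀ z ∈ sphere (0:ℂ) 1, u z ∉ interior D := fun z hz => (hu_bdry.mapsTo hz).2
  have hsplit : ∀ z ∈ closedBall (0:ℂ) 1, z ∈ ball (0:ℂ) 1 ∨ z ∈ sphere (0:ℂ) 1 := by
    intro z hz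
    rw [← ball_union_sphere] at hz
    exact hz
  have hsurj : ∀ q ∈ interior D, ∃ z ∈ ball (0:ℂ) 1, u z = q := by
    intro q hq
    obtain ⟨z, hz, hzq⟩ := rkc_surj E hEc hEconv U hU hb (L q) (by rw [hEint]; exact ⟨q, hq, rfl⟩)
    have hzq' : u z = q := L.injective hzq
    rcases hsplit z hz with h | h
    · exact ⟨z, h, hzq'⟩
    · exact absurd (hzq' ▸ hq) (hdisj z h)
  have hinj' : Set.InjOn u (closedBall (0:ℂ) 1) := by
    intro x hx y hy hxy
    rcases hsplit x hx with h1 | h1 <;> rcases hsplit y hy with h2 | h2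
    · exact hinj h1 h2 hxy
    · exact absurd (hxy ▸ hmaps x h1) (hdisj y h2)
    · exact absurd (hxy ▸ hmaps y h2) (hdisj x h1)
    · exact hu_bdry.injOn h1 h2 hxy
  refine ⟨hinj, ?_⟩
  have : CompactSpace (closedBall (0:ℂ) 1) := isCompact_iff_compactSpace.1 (isCompact_closedBall _ _)
  have hemb : IsEmbedding (fun z : closedBall (0:ℂ) 1 => u z) := by
    refine (Continuous.isClosedEmbedding ?_ ?_).isEmbedding
    · exact continuousOn_iff_continuous_domRestrict.1 hu_cont
    · intro x y hxy; exact Subtype.ext (hinj' x.2 y.2 hxy)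
  have hemb2 : IsEmbedding (fun z : ball (0:ℂ) 1 => u z) :=
    hemb.comp (IsEmbedding.inclusion ball_subset_closedBall)
  have hemb3 : IsEmbedding (fun z : ball (0:ℂ) 1 => (⟨u z, hmaps z z.2⟩ : interior D)) :=
    hemb2.codRestrict (interior D) (fun z => hmaps z z.2)
  refine ⟨hemb3.toHomeomorphOfSurjective ?_, fun z => rfl⟩
  rintro ⟨q, hq⟩
  obtain ⟨z, hz, hzq⟩ := hsurj q hq
  exact ⟨⟨z, hz⟩, Subtype.ext hzq⟩
end
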